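/- Let F ∈ Lip_loc(ℝⁿ) satisfy F(s e₁) = s for s ∈ [0,1] and F(s e₁) ≤ s for s ∈ [−1,0], where e₁ is the first standard basis vector of ℝⁿ, and let g(x) = max{1 − |x₁|, 0} for x = (x₁,…,xₙ) ∈ ℝⁿ. For ε ∈ (0, 1/4), let u^ε be a bounded uniformly continuous viscosity solution of u_t + F(Du) = ε Δu in ℝⁿ×(0,∞) with u^ε(·,0) = g, and let u be a bounded uniformly continuous viscosity solution of u_t + F(Du) = 0 in ℝⁿ×(0,∞) with u(·,0) = g. Then |u^ε(0,1) − u(0,1)| ≥ ((e−1)/(√π · e)) √ε. -/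

import Mathlib

noncomputable section

open MeasureTheory

/-- The spatial Laplacian of `f : ℝⁿ → ℝ` at `x`: the sum of the second directional
derivatives along the standard orthonormal basis vectors. -/
def lap {n : ℕ} (f : EuclideanSpace ℝ (Fin n) → ℝ) (x : EuclideanSpace ℝ (Fin n)) : ℝ :=
  ∑ i, iteratedFDeriv ℝ 2 f x ![EuclideanSpace.single i 1, EuclideanSpace.single i 1]

/-- `w` is a viscosity subsolution of `w_t + G(x, Dw) = ε Δw` in `ℝⁿ × (0,∞)`:
for every `C²` test function `φ` and every point `(x₀,t₀)` with `t₀ > 0` at which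
`w - φ` attains a local maximum, `∂_t φ + G(x₀, Dφ) ≤ ε Δφ` at `(x₀,t₀)`. -/
def IsViscositySubsolution {n : ℕ}
    (G : EuclideanSpace ℝ (Fin n) → EuclideanSpace ℝ (Fin n) → ℝ) (ε : ℝ)
    (w : EuclideanSpace ℝ (Fin n) × ℝ → ℝ) : Prop :=
  ∀ φ : EuclideanSpace ℝ (Fin n) × ℝ → ℝ, ContDiff ℝ 2 φ →
    ∀ (x₀ : EuclideanSpace ℝ (Fin n)) (t₀ : ℝ), 0 < t₀ →
      IsLocalMax (fun p => w p - φ p) (x₀, t₀) →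
      deriv (fun τ => φ (x₀, τ)) t₀ + G x₀ (gradient (fun ξ => φ (ξ, t₀)) x₀)
        ≤ ε * lap (fun ξ => φ (ξ, t₀)) x₀

/-- `w` is a viscosity supersolution of `w_t + G(x, Dw) = ε Δw` in `ℝⁿ × (0,∞)`. -/
def IsViscositySupersolution {n : ℕ}
    (G : EuclideanSpace ℝ (Fin n) → EuclideanSpace ℝ (Fin n) → ℝ) (ε : ℝ)
    (w : EuclideanSpace ℝ (Fin n) × ℝ → ℝ) : Prop :=
  ∀ φ : EuclideanSpace ℝ (Fin n) × ℝ → ℝ, ContDiff ℝ 2 φ →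
    ∀ (x₀ : EuclideanSpace ℝ (Fin n)) (t₀ : ℝ), 0 < t₀ →
      IsLocalMin (fun p => w p - φ p) (x₀, t₀) →
      ε * lap (fun ξ => φ (ξ, t₀)) x₀
        ≤ deriv (fun τ => φ (x₀, τ)) t₀ + G x₀ (gradient (fun ξ => φ (ξ, t₀)) x₀)

/-- `w` is a bounded uniformly continuous viscosity solution of the Cauchy problem
`w_t + G(x, Dw) = ε Δw` in `ℝⁿ × (0,∞)`, `w(·,0) = g`. -/
def IsViscositySolutionCauchy {n : ℕ}
    (G : EuclideanSpace ℝ (Fin n) → EuclideanSpace ℝ (Fin n) → ℝ) (ε : ℝ)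
    (g : EuclideanSpace ℝ (Fin n) → ℝ) (w : EuclideanSpace ℝ (Fin n) × ℝ → ℝ) : Prop :=
  (∃ M : ℝ, ∀ p : EuclideanSpace ℝ (Fin n) × ℝ, |w p| ≤ M) ∧
  UniformContinuousOn w {p : EuclideanSpace ℝ (Fin n) × ℝ | 0 ≤ p.2} ∧
  IsViscositySubsolution G ε w ∧
  IsViscositySupersolution G ε w ∧
  (∀ x : EuclideanSpace ℝ (Fin n), w (x, 0) = g x)

/-- Existence of an interior maximum of the penalized difference. -/
lemma exists_max {n : ℕ} (h : EuclideanSpace ℝ (Fin n) × ℝ → ℝ) (M : ℝ)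
    (hc : ContinuousOn h {p | 0 ≤ p.2}) (hM : ∀ p, 0 ≤ p.2 → h p ≤ M)
    (h0 : ∀ x, h (x, 0) ≤ 0) (η α : ℝ) (hη : 0 < η) (hα : 0 < α) (h1 : η < h (0, 1)) :
    ∃ (x₀ : EuclideanSpace ℝ (Fin n)) (t₀ : ℝ), 0 < t₀ ∧ α * ‖x₀‖ ^ 2 ≤ M ∧
      IsLocalMax (fun p : EuclideanSpace ℝ (Fin n) × ℝ => h p - η * p.2 - α * ‖p.1‖ ^ 2)
        (x₀, t₀) := by
  have hMpos : 0 < M := by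
    have := hM (0, 1) (by norm_num)
    linarith
  set Ψ := fun p : EuclideanSpace ℝ (Fin n) × ℝ => h p - η * p.2 - α * ‖p.1‖ ^ 2 with hΨ
  set R := Real.sqrt (M / α) with hR
  set T := M / η + 1 with hT
  have hRsq : α * R ^ 2 = M := by
    rw [hR, Real.sq_sqrt (by positivity)]; field_simp
  have hTη : η * T = M + η := by rw [hT]; field_simp
  have hcK : IsCompact (Metric.closedBall (0 : EuclideanSpace ℝ (Fin n)) R ×ˢ Set.Icc (0:ℝ) T) :=
    (isCompact_closedBall _ _).prod isCompact_Icc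
  have hΨc : ContinuousOn Ψ {p | 0 ≤ p.2} := by
    refine (hc.sub ?_).sub ?_ <;> fun_prop
  have hmem : ((0 : EuclideanSpace ℝ (Fin n)), (1:ℝ)) ∈
      Metric.closedBall (0 : EuclideanSpace ℝ (Fin n)) R ×ˢ Set.Icc (0:ℝ) T := by
    refine ⟨by simp [hR], by norm_num, ?_⟩
    have : 0 < M / η := by positivity
    simp only [hT]; linarith
  obtain ⟨⟨x₀, t₀⟩, hp, hmax⟩ := hcK.exists_isMaxOn ⟨_, hmem⟩
    (hΨc.mono (fun p hp => hp.2.1))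
  have hpos : 0 < Ψ (x₀, t₀) := by
    have h2 : Ψ (0, 1) ≤ Ψ (x₀, t₀) := hmax hmem
    have h3 : Ψ (0, 1) = h (0, 1) - η := by simp [hΨ]
    linarith
  have ht0 : 0 ≤ t₀ := hp.2.1
  have htpos : 0 < t₀ := by
    rcases ht0.lt_or_eq with h2 | h2
    · exact h2
    · exfalso
      rw [← h2] at hpos
      have h3 : Ψ (x₀, 0) = h (x₀, 0) - α * ‖x₀‖ ^ 2 := by simp [hΨ]
      have := h0 x₀
      have : 0 ≤ α * ‖x₀‖ ^ 2 := by positivity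
      linarith
  refine ⟨x₀, t₀, htpos, ?_, ?_⟩
  · have h2 := hM (x₀, t₀) ht0
    have h3 : Ψ (x₀, t₀) = h (x₀, t₀) - η * t₀ - α * ‖x₀‖ ^ 2 := rfl
    have : 0 ≤ η * t₀ := by positivity
    linarith
  · have hev : ∀ᶠ p : EuclideanSpace ℝ (Fin n) × ℝ in nhds (x₀, t₀), 0 < p.2 :=
      continuous_snd.continuousAt.eventually (lt_mem_nhds htpos)
    filter_upwards [hev] with p hpp
    by_cases hK : p ∈ Metric.closedBall (0 : EuclideanSpace ℝ (Fin n)) R ×ˢ Set.Icc (0:ℝ) T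
    · exact hmax hK
    · refine le_trans ?_ hpos.le
      have h2 := hM p hpp.le
      have h4 : 0 ≤ η * p.2 := by positivity
      have h5 : 0 ≤ α * ‖p.1‖ ^ 2 := by positivity
      show h p - η * p.2 - α * ‖p.1‖ ^ 2 ≤ 0
      by_cases hx : ‖p.1‖ ≤ R
      · have : T < p.2 := by
          by_contra hh
          exact hK ⟨by simpa using hx, hpp.le, not_lt.1 hh⟩
        have : η * T < η * p.2 := by gcongr
        linarith
      · have : R ^ 2 < ‖p.1‖ ^ 2 := by
          have : 0 ≤ R := Real.sqrt_nonneg _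
          have := not_le.1 hx
          gcongr
        have : α * R ^ 2 < α * ‖p.1‖ ^ 2 := by gcongr
        linarith

/-- Localization of the supersolution property: test functions only need to be `C²` near the
point. -/
lemma super_local {n : ℕ} {G : EuclideanSpace ℝ (Fin n) → EuclideanSpace ℝ (Fin n) → ℝ} {ε : ℝ}
    {w : EuclideanSpace ℝ (Fin n) × ℝ → ℝ} (hw : IsViscositySupersolution G ε w)
    (φ : EuclideanSpace ℝ (Fin n) × ℝ → ℝ) (x₀ : EuclideanSpace ℝ (Fin n)) (t₀ : ℝ)
    (ht : 0 < t₀) (hφ : ContDiffAt ℝ 2 φ (x₀, t₀))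
    (hmin : IsLocalMin (fun p => w p - φ p) (x₀, t₀)) :
    ε * lap (fun ξ => φ (ξ, t₀)) x₀
        ≤ deriv (fun τ => φ (x₀, τ)) t₀ + G x₀ (gradient (fun ξ => φ (ξ, t₀)) x₀) := by
  have hev := hφ.eventually (by norm_num)
  obtain ⟨r, hr, hball⟩ := Metric.eventually_nhds_iff_ball.1 hev
  let f : ContDiffBump ((x₀, t₀) : EuclideanSpace ℝ (Fin n) × ℝ) :=
    ⟨r / 4, r / 2, by positivity, by linarith⟩
  set ψ : EuclideanSpace ℝ (Fin n) × ℝ → ℝ := fun p => f p * φ p with hψ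
  have hψc : ContDiff ℝ 2 ψ := by
    rw [contDiff_iff_contDiffAt]
    intro p
    by_cases hp : p ∈ Metric.ball ((x₀, t₀) : EuclideanSpace ℝ (Fin n) × ℝ) r
    · exact (f.contDiff.contDiffAt).mul (hball p hp)
    · have hz : ψ =ᶠ[nhds p] fun _ => 0 := by
        have hpo : p ∈ (Metric.closedBall ((x₀, t₀) : EuclideanSpace ℝ (Fin n) × ℝ) (r / 2))ᶜ := by
          simp only [Set.mem_compl_iff, Metric.mem_closedBall, Metric.mem_ball] at hp ⊢
          linarith
        filter_upwards [Metric.isClosed_closedBall.isOpen_compl.mem_nhds hpo] with q hq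
        have : f q = 0 := by
          apply f.zero_of_le_dist
          simp only [Set.mem_compl_iff, Metric.mem_closedBall] at hq
          exact (not_le.1 hq).le
        simp [hψ, this]
      exact contDiffAt_const.congr_of_eventuallyEq hz
  have heq : ψ =ᶠ[nhds (x₀, t₀)] φ := by
    filter_upwards [f.eventuallyEq_one] with p hp
    simp [hψ, hp]
  have heqx : (fun ξ => ψ (ξ, t₀)) =ᶠ[nhds x₀] fun ξ => φ (ξ, t₀) :=
    (Continuous.continuousAt (f := fun ξ : EuclideanSpace ℝ (Fin n) => (ξ, t₀))
      (by fun_prop)).eventually heq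
  have heqt : (fun τ => ψ (x₀, τ)) =ᶠ[nhds t₀] fun τ => φ (x₀, τ) :=
    (Continuous.continuousAt (f := fun τ : ℝ => (x₀, τ)) (by fun_prop)).eventually heq
  have hmin' : IsLocalMin (fun p => w p - ψ p) (x₀, t₀) := by
    refine hmin.congr ?_
    filter_upwards [heq] with p hp
    rw [hp]
  have key := hw ψ hψc x₀ t₀ ht hmin'
  have e1 : deriv (fun τ => ψ (x₀, τ)) t₀ = deriv (fun τ => φ (x₀, τ)) t₀ := heqt.deriv_eq
  have e2 : gradient (fun ξ => ψ (ξ, t₀)) x₀ = gradient (fun ξ => φ (ξ, t₀)) x₀ := by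
    unfold gradient
    rw [heqx.fderiv_eq]
  have e3 : lap (fun ξ => ψ (ξ, t₀)) x₀ = lap (fun ξ => φ (ξ, t₀)) x₀ := by
    unfold lap
    rw [(Filter.EventuallyEq.iteratedFDeriv ℝ heqx 2).eq_of_nhds]
  rwa [e1, e2, e3] at key

/-- First derivative of the spatial test function. -/
lemma test_hasFDerivAt {n : ℕ} (i₀ : Fin n) (W W' : ℝ → ℝ) (c α : ℝ)
    (hW : ∀ y, HasDerivAt W (W' y) y) (x : EuclideanSpace ℝ (Fin n)) :
    HasFDerivAt (fun ξ : EuclideanSpace ℝ (Fin n) => W (ξ i₀) - c - α * ‖ξ‖ ^ 2)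
      (W' (x i₀) • (EuclideanSpace.proj i₀ : EuclideanSpace ℝ (Fin n) →L[ℝ] ℝ)
        - (2 * α) • (innerSL ℝ x)) x := by
  have h1 : HasFDerivAt (fun ξ : EuclideanSpace ℝ (Fin n) => ξ i₀)
      (EuclideanSpace.proj i₀ : EuclideanSpace ℝ (Fin n) →L[ℝ] ℝ) x :=
    (EuclideanSpace.proj i₀ : EuclideanSpace ℝ (Fin n) →L[ℝ] ℝ).hasFDerivAt
  have h2 := (hW (x i₀)).comp_hasFDerivAt x h1
  have h3 := ((hasStrictFDerivAt_norm_sq x).hasFDerivAt).const_mul α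
  refine ((h2.sub_const c).sub h3).congr_fderiv ?_
  ext v
  simp
  ring

lemma test_gradient {n : ℕ} (i₀ : Fin n) (W W' : ℝ → ℝ) (c α : ℝ)
    (hW : ∀ y, HasDerivAt W (W' y) y) (x : EuclideanSpace ℝ (Fin n)) :
    gradient (fun ξ : EuclideanSpace ℝ (Fin n) => W (ξ i₀) - c - α * ‖ξ‖ ^ 2) x
      = W' (x i₀) • EuclideanSpace.single i₀ (1:ℝ) - (2 * α) • x := by
  apply HasGradientAt.gradient
  rw [hasGradientAt_iff_hasFDerivAt]
  refine (test_hasFDerivAt i₀ W W' c α hW x).congr_fderiv ?_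
  ext v
  simp [EuclideanSpace.inner_single_left]

lemma test_lap {n : ℕ} (i₀ : Fin n) (W W' W'' : ℝ → ℝ) (c α : ℝ)
    (hW : ∀ y, HasDerivAt W (W' y) y) (hW' : ∀ y, HasDerivAt W' (W'' y) y)
    (x : EuclideanSpace ℝ (Fin n)) :
    lap (fun ξ : EuclideanSpace ℝ (Fin n) => W (ξ i₀) - c - α * ‖ξ‖ ^ 2) x
      = W'' (x i₀) - 2 * α * n := by
  have hf : fderiv ℝ (fun ξ : EuclideanSpace ℝ (Fin n) => W (ξ i₀) - c - α * ‖ξ‖ ^ 2)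
      = fun x => W' (x i₀) • (EuclideanSpace.proj i₀ : EuclideanSpace ℝ (Fin n) →L[ℝ] ℝ)
        - (2 * α) • (innerSL ℝ x) := by
    funext x
    exact (test_hasFDerivAt i₀ W W' c α hW x).fderiv
  have h1 : HasFDerivAt (fun ξ : EuclideanSpace ℝ (Fin n) => ξ i₀)
      (EuclideanSpace.proj i₀ : EuclideanSpace ℝ (Fin n) →L[ℝ] ℝ) x :=
    (EuclideanSpace.proj i₀ : EuclideanSpace ℝ (Fin n) →L[ℝ] ℝ).hasFDerivAt
  have h2 := ((hW' (x i₀)).comp_hasFDerivAt x h1).smul_const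
    (EuclideanSpace.proj i₀ : EuclideanSpace ℝ (Fin n) →L[ℝ] ℝ)
  have h3 : HasFDerivAt (fun ξ : EuclideanSpace ℝ (Fin n) => innerSL ℝ ξ)
    (innerSL ℝ : EuclideanSpace ℝ (Fin n) →L[ℝ] EuclideanSpace ℝ (Fin n) →L[ℝ] ℝ) x :=
    (innerSL ℝ : EuclideanSpace ℝ (Fin n) →L[ℝ] EuclideanSpace ℝ (Fin n) →L[ℝ] ℝ).hasFDerivAt
  have h4 := (h2.sub (h3.const_smul (2 * α))).fderiv
  unfold lap
  simp only [iteratedFDeriv_two_apply, hf]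
  have h5 : ∀ i : Fin n, (fderiv ℝ (fun x : EuclideanSpace ℝ (Fin n) =>
      W' (x i₀) • (EuclideanSpace.proj i₀ : EuclideanSpace ℝ (Fin n) →L[ℝ] ℝ)
        - (2 * α) • (innerSL ℝ x)) x) (EuclideanSpace.single i 1) (EuclideanSpace.single i 1)
      = (if i₀ = i then W'' (x i₀) else 0) - 2 * α := by
    intro i
    erw [h4]
    have hin : (innerSL ℝ (EuclideanSpace.single i (1:ℝ))) (EuclideanSpace.single i (1:ℝ)) = 1 := by
      rw [innerSL_apply_apply]; simp
    simp
    rw [hin]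
    split_ifs with hi
    · simp [← hi]
    · simp
  simp only [Matrix.cons_val_zero, Matrix.cons_val_one]
  rw [Finset.sum_congr rfl (fun i _ => h5 i)]
  simp [Finset.sum_sub_distrib]
  ring

/-- Uniform continuity of `F` near the segment. -/
lemma F_unif {n : ℕ} (i₀ : Fin n) (F : EuclideanSpace ℝ (Fin n) → ℝ) (hF : LocallyLipschitz F)
    (η : ℝ) (hη : 0 < η) : ∃ ρ > 0, ∀ p ∈ Set.Icc (-1:ℝ) 1, ∀ v : EuclideanSpace ℝ (Fin n),
      ‖v‖ < ρ → |F (p • EuclideanSpace.single i₀ (1:ℝ) - v)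
        - F (p • EuclideanSpace.single i₀ (1:ℝ))| < η := by
  have huc := (isCompact_closedBall (0 : EuclideanSpace ℝ (Fin n)) 2).uniformContinuousOn_of_continuous
    hF.continuous.continuousOn
  rw [Metric.uniformContinuousOn_iff] at huc
  obtain ⟨ρ, hρ, h⟩ := huc η hη
  refine ⟨min ρ 1, by positivity, fun p hp v hv => ?_⟩
  have hn : ‖p • EuclideanSpace.single i₀ (1:ℝ)‖ ≤ 1 := by
    rw [norm_smul]; simpa using abs_le.2 hp
  have hv1 := hv.trans_le (min_le_left _ _)
  have hv2 := hv.trans_le (min_le_right _ _)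
  have := h (p • EuclideanSpace.single i₀ (1:ℝ) - v) (by
      rw [mem_closedBall_zero_iff]
      exact (norm_sub_le _ _).trans (by linarith))
    (p • EuclideanSpace.single i₀ (1:ℝ)) (by
      rw [mem_closedBall_zero_iff]; linarith) (by simpa [dist_eq_norm] using hv1)
  simpa [Real.dist_eq] using this

/-- Choice of the penalization parameter. -/
lemma exists_alpha (M ρ A η : ℝ) (hM : 0 < M) (hρ : 0 < ρ) (hA : 0 ≤ A) (hη : 0 < η) :
    ∃ α > 0, A * α < η ∧ ∀ {n : ℕ} (x : EuclideanSpace ℝ (Fin n)), α * ‖x‖ ^ 2 ≤ M →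
      ‖(2 * α) • x‖ < ρ := by
  refine ⟨min (η / (2 * (A + 1))) (ρ ^ 2 / (8 * M)), by positivity, ?_, ?_⟩
  · have h1 : A * min (η / (2 * (A + 1))) (ρ ^ 2 / (8 * M)) ≤ A * (η / (2 * (A + 1))) :=
      mul_le_mul_of_nonneg_left (min_le_left _ _) hA
    have h2 : A * (η / (2 * (A + 1))) < η := by
      rw [mul_div_assoc', div_lt_iff₀ (by positivity)]
      nlinarith
    linarith
  · intro n x hx
    have hle : min (η / (2 * (A + 1))) (ρ ^ 2 / (8 * M)) ≤ ρ ^ 2 / (8 * M) := min_le_right _ _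
    have hpos : 0 < min (η / (2 * (A + 1))) (ρ ^ 2 / (8 * M)) := by positivity
    generalize min (η / (2 * (A + 1))) (ρ ^ 2 / (8 * M)) = α at *
    rw [norm_smul, Real.norm_eq_abs, abs_of_pos (by positivity)]
    refine lt_of_pow_lt_pow_left₀ 2 hρ.le ?_
    have h8 : α * (8 * M) ≤ ρ ^ 2 := by rwa [le_div_iff₀ (by positivity)] at hle
    have : α * (α * ‖x‖ ^ 2) ≤ α * M := by gcongr
    have : 0 < ρ ^ 2 := by positivity
    nlinarith

/-- The (unnormalized) error function. -/
def erfE (r : ℝ) : ℝ := ∫ z in (0:ℝ)..r, Real.exp (-z ^ 2)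

lemma erfE_deriv (r : ℝ) : HasDerivAt erfE (Real.exp (-r ^ 2)) r := by
  have hc : Continuous fun z : ℝ => Real.exp (-z ^ 2) := by fun_prop
  exact intervalIntegral.integral_hasDerivAt_right (hc.intervalIntegrable _ _)
    (hc.stronglyMeasurableAtFilter _ _) hc.continuousAt

lemma erfE_contDiff : ContDiff ℝ 2 erfE := by
  have h : ContDiff ℝ (1 + 1) erfE := by
    rw [contDiff_succ_iff_deriv]
    refine ⟨fun r => (erfE_deriv r).differentiableAt, by simp, ?_⟩
    have : deriv erfE = fun r => Real.exp (-r ^ 2) := funext fun r => (erfE_deriv r).deriv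
    rw [this]
    fun_prop
  exact h

lemma erfE_neg (r : ℝ) : erfE (-r) = -erfE r := by
  unfold erfE
  have := intervalIntegral.integral_comp_neg (a := 0) (b := r) (fun z : ℝ => Real.exp (-z ^ 2))
  simp only [neg_sq, neg_zero] at this
  rw [this, intervalIntegral.integral_symm]

lemma erfE_mono : Monotone erfE :=
  monotone_of_deriv_nonneg (fun r => (erfE_deriv r).differentiableAt)
    (fun r => by rw [(erfE_deriv r).deriv]; positivity)

lemma erfE_zero : erfE 0 = 0 := by simp [erfE]

lemma erfE_tendsto : Filter.Tendsto erfE Filter.atTop (nhds (Real.sqrt Real.pi / 2)) := by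
  have h := integral_gaussian_Ioi 1
  have hi := (integrable_exp_neg_mul_sq (b := 1) one_pos).integrableOn (s := Set.Ioi 0)
  have := intervalIntegral_tendsto_integral_Ioi (0:ℝ) hi Filter.tendsto_id
  rw [h] at this
  have h2 : (fun i : ℝ => ∫ x in (0:ℝ)..id i, Real.exp (-1 * x ^ 2)) = erfE := by
    funext i; simp [erfE]
  rw [h2] at this
  simpa using this

lemma erfE_le (r : ℝ) : erfE r ≤ Real.sqrt Real.pi / 2 := erfE_mono.ge_of_tendsto erfE_tendsto r

lemma neg_le_erfE (r : ℝ) : -(Real.sqrt Real.pi / 2) ≤ erfE r := by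
  have := erfE_le (-r)
  rw [erfE_neg] at this
  linarith

lemma mills_aux (c : ℝ) (r : ℝ) (hr : r ≠ 0) :
    HasDerivAt (fun r => erfE r + c * (Real.exp (-r ^ 2) / r))
      (Real.exp (-r ^ 2) * (1 - 2 * c - c / r ^ 2)) r := by
  have h1 : HasDerivAt (fun r : ℝ => Real.exp (-r ^ 2)) (Real.exp (-r ^ 2) * (-(2 * r))) r := by
    have := ((hasDerivAt_pow 2 r).neg).exp
    simpa using this
  refine ((erfE_deriv r).add ((h1.div (hasDerivAt_id r) hr).const_mul c)).congr_deriv ?_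
  simp only [id]
  field_simp
  ring

lemma mills_tendsto (c : ℝ) :
    Filter.Tendsto (fun r => erfE r + c * (Real.exp (-r ^ 2) / r)) Filter.atTop
      (nhds (Real.sqrt Real.pi / 2)) := by
  have h2 : Filter.Tendsto (fun r : ℝ => Real.exp (-r ^ 2) / r) Filter.atTop (nhds 0) := by
    refine squeeze_zero' (g := fun r : ℝ => 1 / r) ?_ ?_ ?_
    · filter_upwards [Filter.eventually_gt_atTop 0] with r hr
      positivity
    · filter_upwards [Filter.eventually_gt_atTop 0] with r hr
      gcongr
      rw [Real.exp_le_one_iff]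
      nlinarith
    · simpa using tendsto_inv_atTop_zero
  simpa using erfE_tendsto.add (h2.const_mul c)

/-- Upper bound for the Gaussian tail. -/
lemma mills_upper (r : ℝ) (hr : 0 < r) :
    Real.sqrt Real.pi / 2 ≤ erfE r + (1 / 2) * (Real.exp (-r ^ 2) / r) := by
  have hanti : AntitoneOn (fun r => erfE r + (1 / 2) * (Real.exp (-r ^ 2) / r)) (Set.Ici r) := by
    refine antitoneOn_of_deriv_nonpos (convex_Ici r) ?_ ?_ ?_
    · intro x hx
      exact (mills_aux _ x (hr.trans_le hx).ne').continuousAt.continuousWithinAt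
    · intro x hx
      rw [interior_Ici] at hx
      exact (mills_aux _ x (hr.trans hx).ne').differentiableAt.differentiableWithinAt
    · intro x hx
      rw [interior_Ici] at hx
      rw [(mills_aux _ x (hr.trans hx).ne').deriv]
      apply mul_nonpos_of_nonneg_of_nonpos (by positivity)
      have : 0 ≤ 1 / 2 / x ^ 2 := by positivity
      linarith
  refine le_of_tendsto (mills_tendsto (1 / 2)) ?_
  filter_upwards [Filter.eventually_ge_atTop r] with x hx
  exact hanti (Set.self_mem_Ici) hx hx

/-- Lower bound for the Gaussian tail. -/
lemma mills_lower (r : ℝ) (hr : 1 ≤ r) :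
    erfE r + (1 / 4) * (Real.exp (-r ^ 2) / r) ≤ Real.sqrt Real.pi / 2 := by
  have hr0 : 0 < r := by linarith
  have hmono : MonotoneOn (fun r => erfE r + (1 / 4) * (Real.exp (-r ^ 2) / r)) (Set.Ici r) := by
    refine monotoneOn_of_deriv_nonneg (convex_Ici r) ?_ ?_ ?_
    · intro x hx
      exact (mills_aux _ x (hr0.trans_le hx).ne').continuousAt.continuousWithinAt
    · intro x hx
      rw [interior_Ici] at hx
      exact (mills_aux _ x (hr0.trans hx).ne').differentiableAt.differentiableWithinAt
    · intro x hx
      rw [interior_Ici] at hx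
      rw [(mills_aux _ x (hr0.trans hx).ne').deriv]
      apply mul_nonneg (by positivity)
      have hx' : r < x := hx
      have : 1 / 4 / x ^ 2 ≤ 1 / 4 := div_le_self (by norm_num) (by nlinarith)
      linarith
  refine ge_of_tendsto (mills_tendsto (1 / 4)) ?_
  filter_upwards [Filter.eventually_ge_atTop r] with x hx
  exact hmono (Set.self_mem_Ici) hx hx

/-- Heat evolution of the positive part, with `s = √(4 ε t)`. -/
def heatP (x s : ℝ) : ℝ :=
  x / 2 + x * erfE (x / s) / Real.sqrt Real.pi
    + s / (2 * Real.sqrt Real.pi) * Real.exp (-(x / s) ^ 2)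

lemma heatP_dx (x s : ℝ) (hs : s ≠ 0) :
    HasDerivAt (fun x => heatP x s) (1 / 2 + erfE (x / s) / Real.sqrt Real.pi) x := by
  have hp : Real.sqrt Real.pi ≠ 0 := by positivity
  have h0 : HasDerivAt (fun x : ℝ => x / s) (1 / s) x := (hasDerivAt_id x).div_const s
  have h1 := (erfE_deriv (x / s)).comp x h0
  have h2 := ((h0.pow 2).neg).exp
  have h3 := (((hasDerivAt_id x).div_const 2).add
    (((hasDerivAt_id x).mul h1).div_const (Real.sqrt Real.pi))).add
    (h2.const_mul (s / (2 * Real.sqrt Real.pi)))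
  refine h3.congr_deriv ?_
  simp only [id, Function.comp, Pi.neg_apply, Pi.pow_apply]
  generalize Real.exp (-(x / s) ^ 2) = e
  generalize erfE (x / s) = E
  norm_num
  field_simp
  ring

lemma heatP_dxx (x s : ℝ) :
    HasDerivAt (fun x => 1 / 2 + erfE (x / s) / Real.sqrt Real.pi)
      (Real.exp (-(x / s) ^ 2) / (s * Real.sqrt Real.pi)) x := by
  have h0 : HasDerivAt (fun x : ℝ => x / s) (1 / s) x := (hasDerivAt_id x).div_const s
  have h1 := (erfE_deriv (x / s)).comp x h0
  refine ((h1.div_const (Real.sqrt Real.pi)).const_add (1 / 2)).congr_deriv ?_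
  ring

/-- Derivative of `heatP` along a curve. -/
lemma heatP_curve (a s : ℝ → ℝ) (a' s' t : ℝ) (ha : HasDerivAt a a' t) (hs : HasDerivAt s s' t)
    (h0 : s t ≠ 0) :
    HasDerivAt (fun t => heatP (a t) (s t))
      ((1 / 2 + erfE (a t / s t) / Real.sqrt Real.pi) * a'
        + Real.exp (-(a t / s t) ^ 2) / (2 * Real.sqrt Real.pi) * s') t := by
  have hp : Real.sqrt Real.pi ≠ 0 := by positivity
  have hq := ha.div hs h0
  have h1 := (erfE_deriv (a t / s t)).comp t hq
  have h2 := ((hq.pow 2).neg).exp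
  have h3 := ((ha.div_const 2).add ((ha.mul h1).div_const (Real.sqrt Real.pi))).add
    ((hs.div_const (2 * Real.sqrt Real.pi)).mul h2)
  refine h3.congr_deriv ?_
  simp only [Function.comp, Pi.neg_apply, Pi.pow_apply, Pi.div_apply]
  generalize Real.exp (-(a t / s t) ^ 2) = e
  generalize erfE (a t / s t) = E
  norm_num
  field_simp
  ring

lemma heatP_dx_mem (r : ℝ) : 1 / 2 + erfE r / Real.sqrt Real.pi ∈ Set.Icc (0:ℝ) 1 := by
  have hp : 0 < Real.sqrt Real.pi := by positivity
  have h1 : erfE r / Real.sqrt Real.pi ≤ 1 / 2 := by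
    rw [div_le_iff₀ hp]; linarith [erfE_le r]
  have h2 : -(1 / 2) ≤ erfE r / Real.sqrt Real.pi := by
    rw [le_div_iff₀ hp]; linarith [neg_le_erfE r]
  constructor <;> linarith

lemma heatP_abs (x s : ℝ) :
    heatP x s = max x 0 - |x| * (1 / 2 - erfE (|x| / s) / Real.sqrt Real.pi)
      + s / (2 * Real.sqrt Real.pi) * Real.exp (-(|x| / s) ^ 2) := by
  unfold heatP
  rcases le_total 0 x with h | h
  · rw [abs_of_nonneg h, max_eq_left h]; ring
  · rw [abs_of_nonpos h, max_eq_right h, neg_div, erfE_neg, neg_sq]; ring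

lemma heatP_le (x s : ℝ) (hs : 0 < s) : heatP x s ≤ max x 0 + s / (2 * Real.sqrt Real.pi) := by
  rw [heatP_abs]
  have h1 : 0 ≤ |x| * (1 / 2 - erfE (|x| / s) / Real.sqrt Real.pi) := by
    apply mul_nonneg (abs_nonneg _)
    linarith [(heatP_dx_mem (|x| / s)).2]
  have h2 : Real.exp (-(|x| / s) ^ 2) ≤ 1 := by
    rw [Real.exp_le_one_iff]
    have : 0 ≤ (|x| / s) ^ 2 := by positivity
    linarith
  have h3 : s / (2 * Real.sqrt Real.pi) * Real.exp (-(|x| / s) ^ 2) ≤ s / (2 * Real.sqrt Real.pi) :=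
    mul_le_of_le_one_right (by positivity) h2
  linarith

lemma le_heatP (x s : ℝ) (hs : 0 < s) : max x 0 ≤ heatP x s := by
  rw [heatP_abs]
  have hp : 0 < Real.sqrt Real.pi := by positivity
  rcases eq_or_ne x 0 with h | h
  · simp [h]; positivity
  · have hx : 0 < |x| := abs_pos.2 h
    have hm := mills_upper (|x| / s) (by positivity)
    have : |x| * (1 / 2 - erfE (|x| / s) / Real.sqrt Real.pi)
        ≤ s / (2 * Real.sqrt Real.pi) * Real.exp (-(|x| / s) ^ 2) := by
      have h2 : |x| / Real.sqrt Real.pi * (Real.sqrt Real.pi / 2)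
        ≤ |x| / Real.sqrt Real.pi *
          (erfE (|x| / s) + (1 / 2) * (Real.exp (-(|x| / s) ^ 2) / (|x| / s))) := by gcongr
      generalize Real.exp (-(|x| / s) ^ 2) = e at *
      generalize erfE (|x| / s) = E at *
      field_simp at h2 ⊢
      linarith
    linarith

/-- Heat evolution of the tent function. -/
def tentV (x s : ℝ) : ℝ := heatP (x + 1) s - 2 * heatP x s + heatP (x - 1) s

lemma tentV_le_one (x s : ℝ) (hs : 0 < s) : tentV x s ≤ 1 := by
  have h1 : Monotone fun x => heatP x s :=
    monotone_of_deriv_nonneg (fun r => (heatP_dx r s hs.ne').differentiableAt)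
      (fun r => by rw [(heatP_dx r s hs.ne').deriv]; exact (heatP_dx_mem _).1)
  have h2 : Monotone fun x => x - heatP x s := by
    have hd : ∀ x, HasDerivAt (fun x => x - heatP x s) _ x :=
      fun x => (hasDerivAt_id x).sub (heatP_dx x s hs.ne')
    refine monotone_of_deriv_nonneg (fun r => (hd r).differentiableAt) (fun r => ?_)
    rw [(hd r).deriv]
    linarith [(heatP_dx_mem (r / s)).2]
  have h3 : heatP (x - 1) s ≤ heatP x s := h1 (by linarith)
  have h4 : x - heatP x s ≤ (x + 1) - heatP (x + 1) s := h2 (by linarith)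
  unfold tentV
  linarith

lemma tentV_init (x s : ℝ) (hs : 0 < s) :
    tentV x s ≤ max (1 - |x|) 0 + s / Real.sqrt Real.pi := by
  have h1 := heatP_le (x + 1) s hs
  have h2 := le_heatP x s hs
  have h3 := heatP_le (x - 1) s hs
  have h4 : max (x + 1) 0 - 2 * max x 0 + max (x - 1) 0 = max (1 - |x|) 0 := by
    rcases abs_cases x with ⟨h, h'⟩ | ⟨h, h'⟩ <;> rw [h] <;> simp only [max_def] <;>
      split_ifs <;> linarith
  have h5 : s / (2 * Real.sqrt Real.pi) + s / (2 * Real.sqrt Real.pi) = s / Real.sqrt Real.pi := by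
    field_simp; ring
  unfold tentV
  linarith

lemma tentV_value (s : ℝ) (hs : 0 < s) (hs1 : s ≤ 1) :
    s / (2 * Real.sqrt Real.pi) * (1 - (Real.exp 1)⁻¹) ≤ tentV (-1) s := by
  have hp : 0 < Real.sqrt Real.pi := by positivity
  have h0 : heatP (-1 + 1) s = s / (2 * Real.sqrt Real.pi) := by simp [heatP]
  have h2 : 0 ≤ heatP (-1 - 1) s := (le_max_right _ _).trans (le_heatP _ s hs)
  have h1 : heatP (-1) s ≤ s / (4 * Real.sqrt Real.pi) * (Real.exp 1)⁻¹ := by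
    rw [heatP_abs]
    simp only [abs_neg, abs_one]
    have hr : 1 ≤ 1 / s := by rw [le_div_iff₀ hs]; linarith
    have hm := mills_lower (1 / s) hr
    have he : Real.exp (-(1 / s) ^ 2) ≤ (Real.exp 1)⁻¹ := by
      rw [← Real.exp_neg, Real.exp_le_exp]
      nlinarith
    rw [max_eq_right (by norm_num)]
    have h3 : (1 / Real.sqrt Real.pi) *
        (erfE (1 / s) + (1 / 4) * (Real.exp (-(1 / s) ^ 2) / (1 / s)))
        ≤ (1 / Real.sqrt Real.pi) * (Real.sqrt Real.pi / 2) := by gcongr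
    have h4 : s / (4 * Real.sqrt Real.pi) * Real.exp (-(1 / s) ^ 2)
      ≤ s / (4 * Real.sqrt Real.pi) * (Real.exp 1)⁻¹ := by gcongr
    generalize (Real.exp 1)⁻¹ = e1 at *
    generalize Real.exp (-(1 / s) ^ 2) = e at *
    generalize erfE (1 / s) = E at *
    refine le_trans ?_ h4
    field_simp at h3 ⊢
    linarith
  unfold tentV
  rw [h0]
  have h5 : s / (4 * Real.sqrt Real.pi) * (Real.exp 1)⁻¹
    = s / (2 * Real.sqrt Real.pi) * (Real.exp 1)⁻¹ / 2 := by field_simp; ring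
  rw [mul_one_sub]
  rw [h5] at h1
  generalize s / (2 * Real.sqrt Real.pi) * (Real.exp 1)⁻¹ = A at *
  generalize s / (2 * Real.sqrt Real.pi) = B at *
  linarith

/-- Upper bound for the inviscid solution. -/
lemma inviscid_le {n : ℕ} (i₀ : Fin n) (F : EuclideanSpace ℝ (Fin n) → ℝ)
    (hF : LocallyLipschitz F)
    (hF1 : ∀ s ∈ Set.Icc (0:ℝ) 1, F (s • EuclideanSpace.single i₀ (1:ℝ)) = s)
    (g : EuclideanSpace ℝ (Fin n) → ℝ)
    (hg : ∀ x : EuclideanSpace ℝ (Fin n), g x = max (1 - |x i₀|) 0)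
    (u : EuclideanSpace ℝ (Fin n) × ℝ → ℝ)
    (hu : IsViscositySolutionCauchy (fun _ q => F q) 0 g u) (δ : ℝ) (hδ : 0 < δ) :
    u (0, 1) ≤ δ / 2 := by
  obtain ⟨⟨M, hM⟩, huc, hsub, -, hinit⟩ := hu
  set q : ℝ → ℝ := fun y => Real.sqrt (y ^ 2 + δ ^ 2) with hq
  set σ : ℝ → ℝ := fun y => (y + q y) / 2 with hσ
  have hqpos : ∀ y, 0 < q y := fun y => Real.sqrt_pos.2 (by positivity)
  have hqabs : ∀ y, |y| ≤ q y := fun y => Real.abs_le_sqrt (by nlinarith [sq_nonneg δ])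
  have hσd : ∀ y, HasDerivAt σ ((1 + y / q y) / 2) y := by
    intro y
    have h1 : HasDerivAt (fun y : ℝ => y ^ 2 + δ ^ 2) (2 * y) y := by
      simpa using (hasDerivAt_pow 2 y).add_const (δ ^ 2)
    have h2 := h1.sqrt (by positivity)
    refine (((hasDerivAt_id y).add h2).div_const 2).congr_deriv ?_
    congr 2
    simp only [hq]
    rw [mul_div_mul_left _ _ two_ne_zero]
  have hσc : ContDiff ℝ 2 σ := by
    have : ContDiff ℝ 2 q := ContDiff.sqrt (by fun_prop) (fun y => by positivity)
    simp only [hσ]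
    fun_prop
  have hσm : ∀ y, (1 + y / q y) / 2 ∈ Set.Icc (0:ℝ) 1 := by
    intro y
    have h1 := abs_le.1 (hqabs y)
    have h2 : y / q y ≤ 1 := by rw [div_le_iff₀ (hqpos y)]; linarith
    have h3 : -1 ≤ y / q y := by rw [le_div_iff₀ (hqpos y)]; linarith
    constructor <;> linarith
  have hσpos : ∀ y, max y 0 ≤ σ y := by
    intro y
    have h1 := abs_le.1 (hqabs y)
    simp only [hσ]
    apply max_le <;> linarith
  have hσ0 : σ 0 = δ / 2 := by
    simp [hσ, hq, Real.sqrt_sq hδ.le]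
  by_contra hcon
  push Not at hcon
  set h : EuclideanSpace ℝ (Fin n) × ℝ → ℝ := fun p => u p - σ (1 + p.1 i₀ - p.2) with hh
  have h01 : h (0, 1) = u (0, 1) - δ / 2 := by
    simp [hh, hσ0]
  set η := h (0, 1) / 2 with hη
  have hηpos : 0 < η := by rw [hη, h01]; linarith
  obtain ⟨ρ, hρ, hFu⟩ := F_unif i₀ F hF η hηpos
  obtain ⟨α, hα, -, hαx⟩ := exists_alpha (|M| + 1) ρ 0 η (by positivity) hρ le_rfl hηpos
  obtain ⟨x₀, t₀, ht₀, hx₀, hmax⟩ := exists_max h (|M| + 1)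
    (by
      refine huc.continuousOn.sub ?_
      refine hσc.continuous.comp_continuousOn ?_
      fun_prop)
    (fun p _ => by
      have h1 := (le_max_right _ _).trans (hσpos (1 + p.1 i₀ - p.2))
      have h2 := (abs_le.1 (hM p)).2
      have := le_abs_self M
      simp only [hh]; linarith)
    (fun x => by
      have h1 := hσpos (1 + x i₀ - 0)
      simp only [hh]
      rw [hinit, hg]
      have h2 : max (1 - |x i₀|) 0 ≤ max (1 + x i₀ - 0) 0 := by
        apply max_le_max_right
        linarith [neg_abs_le (x i₀)]
      linarith)
    η α hηpos hα (by linarith)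
  set φ : EuclideanSpace ℝ (Fin n) × ℝ → ℝ :=
    fun p => σ (1 + p.1 i₀ - p.2) - (-η) * p.2 - (-α) * ‖p.1‖ ^ 2 with hφ
  have hproj : ContDiff ℝ 2 (fun p : EuclideanSpace ℝ (Fin n) × ℝ => p.1 i₀) :=
    ((EuclideanSpace.proj i₀ : EuclideanSpace ℝ (Fin n) →L[ℝ] ℝ).contDiff).comp contDiff_fst
  have hφc : ContDiff ℝ 2 φ := by
    have h1 : ContDiff ℝ 2 (fun p : EuclideanSpace ℝ (Fin n) × ℝ => σ (1 + p.1 i₀ - p.2)) :=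
      hσc.comp ((contDiff_const.add hproj).sub contDiff_snd)
    have h2 : ContDiff ℝ 2 (fun p : EuclideanSpace ℝ (Fin n) × ℝ => ‖p.1‖ ^ 2) :=
      contDiff_fst.norm_sq ℝ
    exact (h1.sub (contDiff_const.mul contDiff_snd)).sub (contDiff_const.mul h2)
  have key := hsub φ hφc x₀ t₀ ht₀ (by
    convert hmax using 2
    simp only [hh, hφ]; ring)
  set y₀ := 1 + x₀ i₀ - t₀ with hy₀
  have e1 : deriv (fun τ => φ (x₀, τ)) t₀ = -((1 + y₀ / q y₀) / 2) + η := by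
    have h1 : HasDerivAt (fun τ : ℝ => 1 + x₀ i₀ - τ) (-1) t₀ := (hasDerivAt_id t₀).const_sub _
    have h2 := (HasDerivAt.comp t₀ (hσd y₀) h1)
    have h3 := (h2.sub ((hasDerivAt_id t₀).const_mul (-η))).sub_const (-α * ‖x₀‖ ^ 2)
    have h4 : HasDerivAt (fun τ => φ (x₀, τ)) _ t₀ := h3
    rw [h4.deriv]; ring
  have e2 : gradient (fun ξ => φ (ξ, t₀)) x₀
      = ((1 + y₀ / q y₀) / 2) • EuclideanSpace.single i₀ (1:ℝ) - (2 * (-α)) • x₀ := by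
    refine test_gradient i₀ (fun y => σ (1 + y - t₀))
      (fun y => (1 + (1 + y - t₀) / q (1 + y - t₀)) / 2) (-η * t₀) (-α) (fun y => ?_) x₀
    have h1 : HasDerivAt (fun y : ℝ => 1 + y - t₀) 1 y :=
      ((hasDerivAt_id y).const_add 1).sub_const t₀
    exact (HasDerivAt.comp y (hσd (1 + y - t₀)) h1).congr_deriv (mul_one _)
  have hmem := hσm y₀
  rw [e1, e2] at key
  have hf := hFu ((1 + y₀ / q y₀) / 2) ⟨by linarith [hmem.1], hmem.2⟩ ((2 * (-α)) • x₀) (by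
    have := hαx x₀ hx₀
    rw [mul_neg, neg_smul, norm_neg]; exact this)
  rw [hF1 _ hmem] at hf
  have := (abs_lt.1 hf).1
  simp only [zero_mul] at key
  linarith

lemma contDiffAt_heatP {E : Type*} [NormedAddCommGroup E] [NormedSpace ℝ E] (a s : E → ℝ) (p : E)
    (ha : ContDiffAt ℝ 2 a p) (hs : ContDiffAt ℝ 2 s p) (h0 : s p ≠ 0) :
    ContDiffAt ℝ 2 (fun p => heatP (a p) (s p)) p := by
  have hq : ContDiffAt ℝ 2 (fun p => a p / s p) p := ha.div hs h0
  have h1 : ContDiffAt ℝ 2 (fun p => erfE (a p / s p)) p :=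
    ContDiffAt.comp p erfE_contDiff.contDiffAt hq
  have h2 : ContDiffAt ℝ 2 (fun p => Real.exp (-(a p / s p) ^ 2)) p := ((hq.pow 2).neg).exp
  exact ((ha.div_const 2).add ((ha.mul h1).div_const _)).add ((hs.div_const _).mul h2)

/-- Lower bound for the viscous solution. -/
lemma viscous_ge {n : ℕ} (i₀ : Fin n) (F : EuclideanSpace ℝ (Fin n) → ℝ)
    (hF : LocallyLipschitz F)
    (hFle : ∀ s ∈ Set.Icc (-1:ℝ) 1, F (s • EuclideanSpace.single i₀ (1:ℝ)) ≤ s)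
    (g : EuclideanSpace ℝ (Fin n) → ℝ)
    (hg : ∀ x : EuclideanSpace ℝ (Fin n), g x = max (1 - |x i₀|) 0)
    (ε : ℝ) (hε : 0 < ε)
    (u : EuclideanSpace ℝ (Fin n) × ℝ → ℝ)
    (hu : IsViscositySolutionCauchy (fun _ q => F q) ε g u) (κ : ℝ) (hκ : 0 < κ) :
    tentV (-1) (Real.sqrt (4 * ε + κ ^ 2)) - κ / Real.sqrt Real.pi ≤ u (0, 1) := by
  obtain ⟨⟨M, hM⟩, huc, -, hsuper, hinit⟩ := hu
  set s : ℝ → ℝ := fun t => Real.sqrt (4 * ε * t + κ ^ 2) with hs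
  have hspos : ∀ t, 0 ≤ t → 0 < s t := fun t ht => Real.sqrt_pos.2 (by positivity)
  set c := κ / Real.sqrt Real.pi with hc
  have hcpos : 0 < c := by positivity
  set h : EuclideanSpace ℝ (Fin n) × ℝ → ℝ :=
    fun p => (tentV (p.1 i₀ - p.2) (s p.2) - c) - u p with hh
  by_contra hcon
  push Not at hcon
  have h01 : h (0, 1) = tentV (-1) (Real.sqrt (4 * ε + κ ^ 2)) - c - u (0, 1) := by
    simp [hh, hs]
  set η := h (0, 1) / 3 with hη
  have hηpos : 0 < η := by rw [hη, h01]; linarith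
  obtain ⟨ρ, hρ, hFu⟩ := F_unif i₀ F hF (η / 2) (half_pos hηpos)
  obtain ⟨α, hα, hαη, hαx⟩ := exists_alpha (|M| + 1) ρ (ε * (2 * n)) (η / 2) (by positivity) hρ
    (by positivity) (half_pos hηpos)
  have hproj : ContDiff ℝ 2 (fun p : EuclideanSpace ℝ (Fin n) × ℝ => p.1 i₀) :=
    ((EuclideanSpace.proj i₀ : EuclideanSpace ℝ (Fin n) →L[ℝ] ℝ).contDiff).comp contDiff_fst
  have hVc : ∀ p : EuclideanSpace ℝ (Fin n) × ℝ, 0 ≤ p.2 →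
      ContDiffAt ℝ 2 (fun p : EuclideanSpace ℝ (Fin n) × ℝ => tentV (p.1 i₀ - p.2) (s p.2)) p := by
    intro p hp
    have hsc : ContDiffAt ℝ 2 (fun p : EuclideanSpace ℝ (Fin n) × ℝ => s p.2) p := by
      have h1 : ContDiffAt ℝ 2
          (fun p : EuclideanSpace ℝ (Fin n) × ℝ => 4 * ε * p.2 + κ ^ 2) p := by fun_prop
      exact h1.sqrt (by positivity)
    have ha : ContDiffAt ℝ 2 (fun p : EuclideanSpace ℝ (Fin n) × ℝ => p.1 i₀ - p.2) p :=
      (hproj.sub contDiff_snd).contDiffAt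
    have h0 := (hspos p.2 hp).ne'
    exact ((contDiffAt_heatP _ _ p (ha.add contDiffAt_const) hsc h0).sub
      (contDiffAt_const.mul (contDiffAt_heatP _ _ p ha hsc h0))).add
      (contDiffAt_heatP _ _ p (ha.sub contDiffAt_const) hsc h0)
  obtain ⟨x₀, t₀, ht₀, hx₀, hmax⟩ := exists_max h (|M| + 1)
    (by
      refine ContinuousOn.sub (ContinuousOn.sub ?_ continuousOn_const) huc.continuousOn
      intro p hp
      exact (hVc p hp).continuousAt.continuousWithinAt)
    (fun p hp => by
      have h1 := tentV_le_one (p.1 i₀ - p.2) (s p.2) (hspos _ hp)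
      have h2 := (abs_le.1 (hM p)).1
      have := le_abs_self M
      simp only [hh]; linarith)
    (fun x => by
      have hs0 : s 0 = κ := by simp [hs, Real.sqrt_sq hκ.le]
      have h1 := tentV_init (x i₀) κ hκ
      simp only [hh]
      rw [hinit, hg, hs0, sub_zero]
      linarith)
    η α hηpos hα (by linarith)
  set φ : EuclideanSpace ℝ (Fin n) × ℝ → ℝ :=
    fun p => (tentV (p.1 i₀ - p.2) (s p.2) - c) - η * p.2 - α * ‖p.1‖ ^ 2 with hφ
  have hφc : ContDiffAt ℝ 2 φ (x₀, t₀) := by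
    have h2 : ContDiff ℝ 2 (fun p : EuclideanSpace ℝ (Fin n) × ℝ => ‖p.1‖ ^ 2) :=
      contDiff_fst.norm_sq ℝ
    exact (((hVc (x₀, t₀) ht₀.le).sub contDiffAt_const).sub
      (contDiffAt_const.mul contDiffAt_snd)).sub (contDiffAt_const.mul h2.contDiffAt)
  have key := super_local hsuper φ x₀ t₀ ht₀ hφc (by
    have h1 := hmax.neg
    have h2 : (fun p => u p - φ p) = fun p => -(h p - η * p.2 - α * ‖p.1‖ ^ 2) := by
      funext p
      simp only [hh, hφ]; ring
    rw [h2]; exact h1)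
  set S := s t₀ with hS
  have hSpos : 0 < S := hspos t₀ ht₀.le
  set D : ℝ → ℝ := fun y => 1 / 2 + erfE (y / S) / Real.sqrt Real.pi with hD
  set D2 : ℝ → ℝ := fun y => Real.exp (-(y / S) ^ 2) / (S * Real.sqrt Real.pi) with hD2
  set y₀ := x₀ i₀ - t₀ with hy₀
  set P := D (y₀ + 1) - 2 * D y₀ + D (y₀ - 1) with hP
  set Q := D2 (y₀ + 1) - 2 * D2 y₀ + D2 (y₀ - 1) with hQ
  have hsd : HasDerivAt s (2 * ε / S) t₀ := by
    have h1 : HasDerivAt (fun t : ℝ => 4 * ε * t + κ ^ 2) (4 * ε) t₀ := by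
      simpa using ((hasDerivAt_id t₀).const_mul (4 * ε)).add_const (κ ^ 2)
    refine (h1.sqrt (by positivity)).congr_deriv ?_
    rw [hS, hs]
    rw [show 4 * ε = 2 * (2 * ε) by ring, mul_div_mul_left _ _ two_ne_zero]
  have e1 : deriv (fun τ => φ (x₀, τ)) t₀ = -P + ε * Q - η := by
    have ha : ∀ b : ℝ, HasDerivAt (fun τ : ℝ => x₀ i₀ - τ + b) (-1) t₀ :=
      fun b => ((hasDerivAt_id t₀).const_sub _).add_const b
    have hcur : ∀ b : ℝ, HasDerivAt (fun τ : ℝ => heatP (x₀ i₀ - τ + b) (s τ))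
        (-D (y₀ + b) + ε * D2 (y₀ + b)) t₀ := by
      intro b
      refine (heatP_curve (fun τ : ℝ => x₀ i₀ - τ + b) s (-1) (2 * ε / S) t₀ (ha b) hsd
        hSpos.ne').congr_deriv ?_
      simp only [hD, hD2, ← hS, ← hy₀]
      have hp : Real.sqrt Real.pi ≠ 0 := by positivity
      generalize Real.exp (-((y₀ + b) / S) ^ 2) = e
      generalize erfE ((y₀ + b) / S) = E
      field_simp
    have hA := hcur 1
    have hB := hcur 0
    have hC := hcur (-1)
    simp only [add_zero, ← sub_eq_add_neg] at hA hB hC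
    have h3 := ((((hA.sub (hB.const_mul 2)).add hC).sub_const c).sub
      ((hasDerivAt_id t₀).const_mul η)).sub_const (α * ‖x₀‖ ^ 2)
    have h4 : HasDerivAt (fun τ => φ (x₀, τ)) _ t₀ := h3
    rw [h4.deriv, hP, hQ]; ring
  have hb1 : ∀ b y : ℝ, HasDerivAt (fun y => heatP (y - t₀ + b) S) (D (y - t₀ + b)) y := by
    intro b y
    have h1 : HasDerivAt (fun y : ℝ => y - t₀ + b) 1 y :=
      ((hasDerivAt_id y).sub_const t₀).add_const b
    exact (HasDerivAt.comp y (heatP_dx (y - t₀ + b) S hSpos.ne') h1).congr_deriv (mul_one _)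
  have hb2 : ∀ b y : ℝ, HasDerivAt (fun y => D (y - t₀ + b)) (D2 (y - t₀ + b)) y := by
    intro b y
    have h1 : HasDerivAt (fun y : ℝ => y - t₀ + b) 1 y :=
      ((hasDerivAt_id y).sub_const t₀).add_const b
    exact (HasDerivAt.comp y (heatP_dxx (y - t₀ + b) S) h1).congr_deriv (mul_one _)
  have hW1 : ∀ y, HasDerivAt (fun y => tentV (y - t₀) S - c)
      (D (y - t₀ + 1) - 2 * D (y - t₀) + D (y - t₀ - 1)) y := by
    intro y
    have hA := hb1 1 y
    have hB := hb1 0 y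
    have hC := hb1 (-1) y
    simp only [add_zero, ← sub_eq_add_neg] at hA hB hC
    exact ((hA.sub (hB.const_mul 2)).add hC).sub_const c
  have hW2 : ∀ y, HasDerivAt (fun y => D (y - t₀ + 1) - 2 * D (y - t₀) + D (y - t₀ - 1))
      (D2 (y - t₀ + 1) - 2 * D2 (y - t₀) + D2 (y - t₀ - 1)) y := by
    intro y
    have hA := hb2 1 y
    have hB := hb2 0 y
    have hC := hb2 (-1) y
    simp only [add_zero, ← sub_eq_add_neg] at hA hB hC
    exact (hA.sub (hB.const_mul 2)).add hC
  have e2 : gradient (fun ξ => φ (ξ, t₀)) x₀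
      = P • EuclideanSpace.single i₀ (1:ℝ) - (2 * α) • x₀ :=
    test_gradient i₀ (fun y => tentV (y - t₀) S - c) _ (η * t₀) α hW1 x₀
  have e3 : lap (fun ξ => φ (ξ, t₀)) x₀ = Q - 2 * α * n :=
    test_lap i₀ (fun y => tentV (y - t₀) S - c) _ _ (η * t₀) α hW1 hW2 x₀
  have hDm : ∀ y, D y ∈ Set.Icc (0:ℝ) 1 := fun y => heatP_dx_mem (y / S)
  have hDmono : Monotone D := by
    intro a b hab
    simp only [hD]
    have : erfE (a / S) ≤ erfE (b / S) := erfE_mono (by gcongr)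
    gcongr
  have hPm : P ∈ Set.Icc (-1:ℝ) 1 := by
    have h1 := hDm (y₀ + 1)
    have h2 := hDm y₀
    have h3 := hDm (y₀ - 1)
    have h4 : D y₀ ≤ D (y₀ + 1) := hDmono (by linarith)
    have h5 : D (y₀ - 1) ≤ D y₀ := hDmono (by linarith)
    constructor <;> linarith [h1.1, h1.2, h2.1, h2.2, h3.1, h3.2]
  rw [e1, e2, e3] at key
  have hf := (abs_lt.1 (hFu P hPm ((2 * α) • x₀) (hαx x₀ hx₀))).2
  have hfp := hFle P hPm
  have : ε * (Q - 2 * α * n) = ε * Q - ε * (2 * n) * α := by ring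
  linarith

/-- If `F ∈ Lip_loc(ℝⁿ)` satisfies `F(s e₁) = s` for `s ∈ [0,1]` and
`F(s e₁) ≤ s` for `s ∈ [-1,0]`, and `g(x) = max{1-|x₁|,0}`, then for `ε ∈ (0,1/4)` the
viscosity solutions `u^ε` of `u_t + F(Du) = ε Δu` and `u` of `u_t + F(Du) = 0` with
initial datum `g` satisfy `|u^ε(0,1) - u(0,1)| ≥ ((e-1)/(√π e)) √ε`. -/
theorem statement3
    (n : ℕ) (hn : 0 < n)
    (F : EuclideanSpace ℝ (Fin n) → ℝ) (hF : LocallyLipschitz F)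
    (hF1 : ∀ s ∈ Set.Icc (0:ℝ) 1,
      F (s • EuclideanSpace.single (⟨0, hn⟩ : Fin n) (1:ℝ)) = s)
    (hF2 : ∀ s ∈ Set.Icc (-1:ℝ) 0,
      F (s • EuclideanSpace.single (⟨0, hn⟩ : Fin n) (1:ℝ)) ≤ s)
    (g : EuclideanSpace ℝ (Fin n) → ℝ)
    (hg : ∀ x : EuclideanSpace ℝ (Fin n), g x = max (1 - |x ⟨0, hn⟩|) 0)
    (ε : ℝ) (hε : ε ∈ Set.Ioo (0:ℝ) (1/4))
    (uε u : EuclideanSpace ℝ (Fin n) × ℝ → ℝ)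
    (huε : IsViscositySolutionCauchy (fun _ q => F q) ε g uε)
    (hu : IsViscositySolutionCauchy (fun _ q => F q) 0 g u) :
    (Real.exp 1 - 1) / (Real.sqrt Real.pi * Real.exp 1) * Real.sqrt ε
      ≤ |uε (0, 1) - u (0, 1)| := by
  have hle : u (0, 1) ≤ 0 := by
    refine le_of_forall_pos_le_add fun δ hδ => ?_
    have := inviscid_le ⟨0, hn⟩ F hF hF1 g hg u hu δ hδ
    linarith
  have hFle : ∀ s ∈ Set.Icc (-1:ℝ) 1,
      F (s • EuclideanSpace.single (⟨0, hn⟩ : Fin n) (1:ℝ)) ≤ s := by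
    intro s hs
    rcases le_total 0 s with h | h
    · exact (hF1 s ⟨h, hs.2⟩).le
    · exact hF2 s ⟨hs.1, h⟩
  obtain ⟨hε0, hε1⟩ := hε
  have hp : 0 < Real.sqrt Real.pi := by positivity
  have hge : (Real.exp 1 - 1) / (Real.sqrt Real.pi * Real.exp 1) * Real.sqrt ε ≤ uε (0, 1) := by
    refine le_of_forall_pos_le_add fun δ hδ => ?_
    set κ := min (δ * Real.sqrt Real.pi) (Real.sqrt (1 - 4 * ε)) with hκ
    have hκpos : 0 < κ := lt_min (by positivity) (Real.sqrt_pos.2 (by linarith))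
    have hκ1 : κ / Real.sqrt Real.pi ≤ δ := by
      rw [div_le_iff₀ hp]; exact min_le_left _ _
    have hκ2 : κ ^ 2 ≤ 1 - 4 * ε := by
      have h1 : κ ≤ Real.sqrt (1 - 4 * ε) := min_le_right _ _
      calc κ ^ 2 ≤ (Real.sqrt (1 - 4 * ε)) ^ 2 := by gcongr
        _ = 1 - 4 * ε := Real.sq_sqrt (by linarith)
    have h1 := viscous_ge ⟨0, hn⟩ F hF hFle g hg ε hε0 uε huε κ hκpos
    have hs1 : Real.sqrt (4 * ε + κ ^ 2) ≤ 1 := by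
      rw [Real.sqrt_le_iff]; constructor <;> linarith
    have h2 := tentV_value (Real.sqrt (4 * ε + κ ^ 2)) (Real.sqrt_pos.2 (by positivity)) hs1
    have h3 : 2 * Real.sqrt ε ≤ Real.sqrt (4 * ε + κ ^ 2) := by
      apply Real.le_sqrt_of_sq_le
      rw [mul_pow, Real.sq_sqrt hε0.le]
      nlinarith
    have h4 : 0 ≤ 1 - (Real.exp 1)⁻¹ := by
      have : (Real.exp 1)⁻¹ ≤ 1 := inv_le_one_of_one_le₀ (Real.one_le_exp (by norm_num))
      linarith
    have h5 : 2 * Real.sqrt ε / (2 * Real.sqrt Real.pi) * (1 - (Real.exp 1)⁻¹)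
        ≤ Real.sqrt (4 * ε + κ ^ 2) / (2 * Real.sqrt Real.pi) * (1 - (Real.exp 1)⁻¹) := by
      gcongr
    have h6 : (Real.exp 1 - 1) / (Real.sqrt Real.pi * Real.exp 1) * Real.sqrt ε
        = 2 * Real.sqrt ε / (2 * Real.sqrt Real.pi) * (1 - (Real.exp 1)⁻¹) := by
      field_simp
    linarith
  exact le_trans (by linarith) (le_abs_self _)
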